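/- arXiv:2303.17692 — 3 statements merged into one kernel-verified Lean document; each statement's English description precedes it below -/
import Mathlib

section
/- Let X ⊆ ℝ^n and D ⊆ ℝ^r be open convex sets and let g : X × D → ℝ^n be continuously differentiable such that, at every point of X × D, the state Jacobian ∂g/∂x is Metzler (all off-diagonal entries are nonnegative) and the parameter Jacobian ∂g/∂d has all entries nonnegative. Let d₁, d₂ : [0,T] → D be continuous inputs with d₁(t) ≤ d₂(t) componentwise for all t ∈ [0,T], and let x₁, x₂ : [0,T] → X be differentiable functions satisfying xᵢ'(t) = g(xᵢ(t), dᵢ(t)) for all t ∈ [0,T] and i = 1,2. If x₁(0) ≤ x₂(0) componentwise, then x₁(t) ≤ x₂(t) componentwise for all t ∈ [0,T]. -/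
open Set

open scoped Topology

/-- A differentiable curve in `ℝⁿ` that starts in the nonnegative orthant stays there if each
nonpositive minimal coordinate `e t i` has derivative at least `L * e t i`. -/
theorem nonneg_of_mul_le_deriv_of_min {n : ℕ} {T L : ℝ} {e e' : ℝ → Fin n → ℝ}
    (he : ∀ t ∈ Icc 0 T, HasDerivAt e (e' t) t)
    (hL : ∀ t ∈ Icc 0 T, ∀ i, e t i ≤ 0 → (∀ j, e t i ≤ e t j) → L * e t i ≤ e' t i)
    (h0 : 0 ≤ e 0) : ∀ t ∈ Icc 0 T, 0 ≤ e t := by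
  have key : ∀ ε > 0, ∀ t ∈ Icc 0 T, ∀ i, 0 < e t i + ε * Real.exp ((L + 1) * t) := by
    intro ε hε
    by_contra! hcon
    obtain ⟨t₀, ht₀, i₀, hi₀⟩ := hcon
    set w : Fin n → ℝ → ℝ := fun i t => e t i + ε * Real.exp ((L + 1) * t) with hw
    have hw' : ∀ i, ∀ t ∈ Icc 0 T,
        HasDerivAt (w i) (e' t i + ε * (Real.exp ((L + 1) * t) * (L + 1))) t := by
      intro i t ht
      have h₁ : HasDerivAt (fun t => (L + 1) * t) (L + 1) t := by
        simpa using (hasDerivAt_id t).const_mul (L + 1)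
      exact (hasDerivAt_pi.1 (he t ht) i).add (h₁.exp.const_mul ε)
    have hwc : ∀ i, ContinuousOn (w i) (Icc 0 T) := fun i t ht =>
      (hw' i t ht).continuousAt.continuousWithinAt
    have hS : IsCompact (⋃ i, Icc 0 T ∩ w i ⁻¹' Iic 0) :=
      isCompact_iUnion fun i =>
        isCompact_Icc.of_isClosed_subset
          ((hwc i).preimage_isClosed_of_isClosed isClosed_Icc isClosed_Iic) inter_subset_left
    obtain ⟨s, hs, hmin⟩ := hS.exists_isLeast ⟨t₀, mem_iUnion.2 ⟨i₀, ht₀, hi₀⟩⟩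
    obtain ⟨i, hsT, hsi⟩ := mem_iUnion.1 hs
    have hpos : ∀ j, ∀ t ∈ Ico 0 s, 0 < w j t := by
      intro j t ht
      by_contra! h
      exact absurd (hmin (mem_iUnion.2 ⟨j, ⟨ht.1, ht.2.le.trans hsT.2⟩, h⟩)) (not_le.2 ht.2)
    have hs0 : 0 < s := by
      refine hsT.1.lt_of_ne ?_
      rintro rfl
      have h₁ : e 0 i + ε * Real.exp ((L + 1) * 0) ≤ 0 := hsi
      have h₂ : 0 ≤ e 0 i := h0 i
      have h₃ := Real.exp_pos ((L + 1) * 0)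
      nlinarith [mul_pos hε h₃]
    have hnear : ∀ᶠ t in 𝓝[<] s, t ∈ Ico 0 s := Ico_mem_nhdsLT hs0
    have hnonneg : ∀ j, 0 ≤ w j s := fun j =>
      ge_of_tendsto ((hw' j s hsT).continuousAt.tendsto.mono_left nhdsWithin_le_nhds)
        (hnear.mono fun t ht => (hpos j t ht).le)
    have hzero : w i s = 0 := le_antisymm hsi (hnonneg i)
    have hder : e' s i + ε * (Real.exp ((L + 1) * s) * (L + 1)) ≤ 0 := by
      have h₁ := (hasDerivAt_iff_tendsto_slope.1 (hw' i s hsT)).mono_left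
        (nhdsWithin_mono s fun t (ht : t ∈ Iio s) => ht.ne)
      refine le_of_tendsto h₁ (hnear.mono fun t ht => ?_)
      rw [slope_def_field, hzero]
      exact div_nonpos_of_nonneg_of_nonpos (by linarith [hpos i t ht]) (by linarith [ht.2])
    have hE := mul_pos hε (Real.exp_pos ((L + 1) * s))
    simp only [hw] at hzero hnonneg
    have hle := hL s hsT i (by linarith) fun j => by linarith [hnonneg j]
    have hei : e s i = -(ε * Real.exp ((L + 1) * s)) := by linarith
    rw [hei] at hle
    linarith
  intro t ht i
  refine le_of_forall_pos_lt_add fun δ hδ => ?_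
  have hE := Real.exp_pos ((L + 1) * t)
  have := key (δ / Real.exp ((L + 1) * t)) (by positivity) t ht i
  rwa [div_mul_cancel₀ _ hE.ne'] at this

/-- A linear functional that is nonnegative on the standard basis vectors other than the `i`-th
is nonnegative on nonnegative vectors whose `i`-th coordinate vanishes. -/
theorem ContinuousLinearMap.nonneg_of_single_nonneg {ι : Type*} [Fintype ι] [DecidableEq ι]
    (ℓ : (ι → ℝ) →L[ℝ] ℝ) {v : ι → ℝ} (hv : 0 ≤ v)
    (hℓ : ∀ j, v j ≠ 0 → 0 ≤ ℓ (Pi.single j 1)) : 0 ≤ ℓ v := by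
  rw [← Finset.univ_sum_single v, map_sum]
  refine Finset.sum_nonneg fun j _ => ?_
  have h : (Pi.single j (v j) : ι → ℝ) = v j • Pi.single j 1 := by
    rw [← Pi.single_smul, smul_eq_mul, mul_one]
  rw [h, map_smul, smul_eq_mul]
  by_cases hj : v j = 0
  · simp [hj]
  · exact mul_nonneg (hv j) (hℓ j hj)

/-- **Monotonicity from Metzler/nonnegative Jacobians.**
If `g : X × D → ℝⁿ` is C¹ on the open convex sets `X ⊆ ℝⁿ`, `D ⊆ ℝʳ`, its state
Jacobian is Metzler and its parameter Jacobian is entrywise nonnegative everywhere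
on `X × D`, then solutions with componentwise-ordered initial conditions and
componentwise-ordered continuous inputs stay componentwise ordered on `[0,T]`. -/
theorem monotone_of_metzler_jacobian
    (n r : ℕ)
    (X : Set (Fin n → ℝ)) (D : Set (Fin r → ℝ))
    (hXopen : IsOpen X) (hXconv : Convex ℝ X)
    (hDopen : IsOpen D) (hDconv : Convex ℝ D)
    (g : (Fin n → ℝ) → (Fin r → ℝ) → (Fin n → ℝ))
    (hg : ContDiffOn ℝ 1 (fun p : (Fin n → ℝ) × (Fin r → ℝ) => g p.1 p.2) (X ×ˢ D))
    (hMetzler : ∀ x ∈ X, ∀ d ∈ D, ∀ i j : Fin n, i ≠ j →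
      0 ≤ fderiv ℝ (fun x' => g x' d i) x (Pi.single j 1))
    (hParam : ∀ x ∈ X, ∀ d ∈ D, ∀ (i : Fin n) (j : Fin r),
      0 ≤ fderiv ℝ (fun d' => g x d' i) d (Pi.single j 1))
    (T : ℝ) (hT : 0 ≤ T)
    (d₁ d₂ : ℝ → (Fin r → ℝ))
    (hd₁cont : ContinuousOn d₁ (Icc 0 T)) (hd₂cont : ContinuousOn d₂ (Icc 0 T))
    (hd₁mem : ∀ t ∈ Icc 0 T, d₁ t ∈ D) (hd₂mem : ∀ t ∈ Icc 0 T, d₂ t ∈ D)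
    (hdord : ∀ t ∈ Icc 0 T, d₁ t ≤ d₂ t)
    (x₁ x₂ : ℝ → (Fin n → ℝ))
    (hx₁mem : ∀ t ∈ Icc 0 T, x₁ t ∈ X) (hx₂mem : ∀ t ∈ Icc 0 T, x₂ t ∈ X)
    (hx₁ : ∀ t ∈ Icc 0 T, HasDerivAt x₁ (g (x₁ t) (d₁ t)) t)
    (hx₂ : ∀ t ∈ Icc 0 T, HasDerivAt x₂ (g (x₂ t) (d₂ t)) t)
    (h0 : x₁ 0 ≤ x₂ 0) :
    ∀ t ∈ Icc 0 T, x₁ t ≤ x₂ t := by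
  set f : (Fin n → ℝ) × (Fin r → ℝ) → Fin n → ℝ := fun p => g p.1 p.2
  have hopen : IsOpen (X ×ˢ D) := hXopen.prod hDopen
  have hconv : Convex ℝ (X ×ˢ D) := hXconv.prod hDconv
  have hdiff : ∀ p ∈ X ×ˢ D, HasFDerivAt f (fderiv ℝ f p) p := fun p hp =>
    ((hg.differentiableOn one_ne_zero).differentiableAt (hopen.mem_nhds hp)).hasFDerivAt
  have hdiffi : ∀ i, ∀ p ∈ X ×ˢ D, HasFDerivAt (fun p => f p i)
      ((ContinuousLinearMap.proj i : (Fin n → ℝ) →L[ℝ] ℝ).comp (fderiv ℝ f p)) p :=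
    fun i p hp => hasFDerivAt_pi'.1 (hdiff p hp) i
  have hX : ∀ p ∈ X ×ˢ D, ∀ i v,
      fderiv ℝ (fun x' => g x' p.2 i) p.1 v = fderiv ℝ f p (v, 0) i := by
    intro p hp i v
    have h := HasFDerivAt.comp (g := fun p => f p i) (f := fun x' => (x', p.2)) p.1
      (hdiffi i p hp) (hasFDerivAt_prodMk_left p.1 p.2)
    exact congrArg (fun ℓ => ℓ v) h.fderiv
  have hD : ∀ p ∈ X ×ˢ D, ∀ i v,
      fderiv ℝ (fun d' => g p.1 d' i) p.2 v = fderiv ℝ f p (0, v) i := by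
    intro p hp i v
    have h := HasFDerivAt.comp (g := fun p => f p i) (f := fun d' => (p.1, d')) p.2
      (hdiffi i p hp) (hasFDerivAt_prodMk_right p.1 p.2)
    exact congrArg (fun ℓ => ℓ v) h.fderiv
  set p₁ : ℝ → (Fin n → ℝ) × (Fin r → ℝ) := fun t => (x₁ t, d₁ t) with hp₁
  set p₂ : ℝ → (Fin n → ℝ) × (Fin r → ℝ) := fun t => (x₂ t, d₂ t) with hp₂
  have hp₁c : ContinuousOn p₁ (Icc 0 T) :=
    ContinuousOn.prodMk (fun t ht => (hx₁ t ht).continuousAt.continuousWithinAt) hd₁cont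
  have hp₂c : ContinuousOn p₂ (Icc 0 T) :=
    ContinuousOn.prodMk (fun t ht => (hx₂ t ht).continuousAt.continuousWithinAt) hd₂cont
  have hseg : ∀ t ∈ Icc 0 T, segment ℝ (p₁ t) (p₂ t) ⊆ X ×ˢ D := fun t ht =>
    hconv.segment_subset ⟨hx₁mem t ht, hd₁mem t ht⟩ ⟨hx₂mem t ht, hd₂mem t ht⟩
  obtain ⟨M, hM⟩ : ∃ M, ∀ t ∈ Icc 0 T, ∀ p ∈ segment ℝ (p₁ t) (p₂ t), ‖fderiv ℝ f p‖ ≤ M := by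
    set σ : ℝ × ℝ → (Fin n → ℝ) × (Fin r → ℝ) :=
      fun q => p₁ q.2 + q.1 • (p₂ q.2 - p₁ q.2)
    have hσc : ContinuousOn σ (Icc 0 1 ×ˢ Icc 0 T) := by
      have h₁ : ContinuousOn (fun q : ℝ × ℝ => p₁ q.2) (Icc 0 1 ×ˢ Icc 0 T) :=
        hp₁c.comp continuousOn_snd fun q hq => hq.2
      have h₂ : ContinuousOn (fun q : ℝ × ℝ => p₂ q.2) (Icc 0 1 ×ˢ Icc 0 T) :=
        hp₂c.comp continuousOn_snd fun q hq => hq.2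
      exact h₁.add (continuousOn_fst.smul (h₂.sub h₁))
    have hmaps : MapsTo σ (Icc 0 1 ×ˢ Icc 0 T) (X ×ˢ D) := fun q hq =>
      hseg q.2 hq.2 (by rw [segment_eq_image']; exact ⟨q.1, hq.1, rfl⟩)
    obtain ⟨M, hM⟩ := (isCompact_Icc.prod isCompact_Icc).exists_bound_of_continuousOn
      ((hg.continuousOn_fderiv_of_isOpen hopen le_rfl).comp hσc hmaps)
    refine ⟨M, fun t ht p hp => ?_⟩
    rw [segment_eq_image'] at hp
    obtain ⟨θ, hθ, rfl⟩ := hp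
    exact hM (θ, t) ⟨hθ, ht⟩
  have hmain := nonneg_of_mul_le_deriv_of_min (L := M)
    (fun t ht => (hx₂ t ht).sub (hx₁ t ht)) ?_ (by simpa using h0)
  · exact fun t ht => sub_nonneg.1 (hmain t ht)
  intro t ht i hi hmin
  obtain ⟨p, hp, hpe⟩ := domain_mvt (f := fun p => f p i)
    (fun p hp => (hdiffi i p hp).hasFDerivWithinAt) hconv
    (hseg t ht (left_mem_segment ℝ _ _)) (hseg t ht (right_mem_segment ℝ _ _))
  have hpmem := hseg t ht hp
  set e : Fin n → ℝ := x₂ t - x₁ t with he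
  set m : ℝ := e i with hm
  have hsplit : p₂ t - p₁ t = (e - (fun _ => m), 0) + ((fun _ => m), 0) + (0, d₂ t - d₁ t) := by
    simp [hp₁, hp₂, he]
  have hstate : 0 ≤ fderiv ℝ f p (e - (fun _ => m), 0) i := by
    rw [← hX p hpmem]
    refine ContinuousLinearMap.nonneg_of_single_nonneg _ (fun j => sub_nonneg.2 (hmin j))
      fun j hj => hMetzler p.1 hpmem.1 p.2 hpmem.2 i j ?_
    rintro rfl
    simp [hm] at hj
  have hparam : 0 ≤ fderiv ℝ f p (0, d₂ t - d₁ t) i := by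
    rw [← hD p hpmem]
    exact ContinuousLinearMap.nonneg_of_single_nonneg _ (sub_nonneg.2 (hdord t ht))
      fun j _ => hParam p.1 hpmem.1 p.2 hpmem.2 i j
  have hdiag : M * m ≤ fderiv ℝ f p ((fun _ => m), 0) i := by
    have h₁ : ‖(((fun _ => m), 0) : (Fin n → ℝ) × (Fin r → ℝ))‖ ≤ |m| := by
      rw [Prod.norm_mk, norm_zero]
      exact max_le ((pi_norm_le_iff_of_nonneg (abs_nonneg m)).2 fun _ => le_rfl) (abs_nonneg m)
    have h₂ : |fderiv ℝ f p ((fun _ => m), 0) i| ≤ M * |m| :=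
      (norm_le_pi_norm _ i).trans (((fderiv ℝ f p).le_opNorm _).trans
        (mul_le_mul (hM t ht p hp) h₁ (norm_nonneg _) ((norm_nonneg _).trans (hM t ht p hp))))
    rw [abs_of_nonpos (show m ≤ 0 from hi)] at h₂
    linarith [neg_abs_le (fderiv ℝ f p ((fun _ => m), 0) i)]
  have hsum : g (x₂ t) (d₂ t) i - g (x₁ t) (d₁ t) i =
      fderiv ℝ f p (e - (fun _ => m), 0) i + fderiv ℝ f p ((fun _ => m), 0) i +
        fderiv ℝ f p (0, d₂ t - d₁ t) i := by
    rw [hsplit] at hpe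
    simpa only [map_add, ContinuousLinearMap.comp_apply, ContinuousLinearMap.proj_apply,
      Pi.add_apply] using hpe
  change M * m ≤ g (x₂ t) (d₂ t) i - g (x₁ t) (d₁ t) i
  linarith
end

section
/- Let X ⊆ ℝ^n and D ⊆ ℝ^r be open convex sets and let g : X × D → ℝ^n be continuously differentiable. Suppose the system ẋ = g(x, d) is monotone in the following sense: for every pair of constant inputs d₁, d₂ ∈ D with d₁ ≤ d₂ componentwise, every T > 0, and every pair of differentiable solutions x₁, x₂ : [0,T] → X of xᵢ'(t) = g(xᵢ(t), dᵢ) with x₁(0) ≤ x₂(0) componentwise, one has x₁(t) ≤ x₂(t) componentwise for all t ∈ [0,T]. Then at every point of X × D the state Jacobian ∂g/∂x is Metzler (all off-diagonal entries are nonnegative) and the parameter Jacobian ∂g/∂d has all entries nonnegative. -/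
open Set Filter Topology

lemma HasDerivAt.nonneg_of_eventually_le_right {φ : ℝ → ℝ} {φ' a : ℝ} (h : HasDerivAt φ φ' a)
    (hle : ∀ᶠ t in 𝓝[>] (0 : ℝ), φ a ≤ φ (a + t)) : 0 ≤ φ' := by
  refine ge_of_tendsto h.tendsto_slope_zero_right ?_
  filter_upwards [hle, self_mem_nhdsWithin] with t ht ht0
  exact smul_nonneg (inv_nonneg.2 (le_of_lt ht0)) (sub_nonneg.2 ht)

lemma DifferentiableAt.fderiv_nonneg_of_eventually_le {E : Type*} [NormedAddCommGroup E]
    [NormedSpace ℝ E] {f : E → ℝ} {x v : E} (hf : DifferentiableAt ℝ f x)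
    (hle : ∀ᶠ t in 𝓝[>] (0 : ℝ), f x ≤ f (x + t • v)) : 0 ≤ fderiv ℝ f x v := by
  have h : HasDerivAt (fun t : ℝ => f (x + t • v)) (fderiv ℝ f x v) 0 :=
    hf.hasFDerivAt.hasLineDerivAt v
  exact h.nonneg_of_eventually_le_right (by simpa using hle)

lemma IsOpen.eventually_add_smul_mem_nhdsGT {E : Type*} [NormedAddCommGroup E]
    [NormedSpace ℝ E] {s : Set E} (hs : IsOpen s) {x : E} (hx : x ∈ s) (v : E) :
    ∀ᶠ t in 𝓝[>] (0 : ℝ), x + t • v ∈ s := by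
  have hc : Tendsto (fun t : ℝ => x + t • v) (𝓝 0) (𝓝 x) :=
    Continuous.tendsto' (by fun_prop) _ _ (by simp)
  exact nhdsWithin_le_nhds (hc (hs.mem_nhds hx))

lemma ContDiffAt.exists_eventually_hasDerivAt_mem {E : Type*} [NormedAddCommGroup E]
    [NormedSpace ℝ E] [CompleteSpace E] {f : E → E} {x : E} (hf : ContDiffAt ℝ 1 f x)
    {s : Set E} (hs : s ∈ 𝓝 x) :
    ∃ α : ℝ → E, α 0 = x ∧ ∀ᶠ t in 𝓝 (0 : ℝ), HasDerivAt α (f (α t)) t ∧ α t ∈ s := by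
  obtain ⟨α, hα, ε, hε, h⟩ :=
    hf.exists_forall_mem_closedBall_exists_eq_forall_mem_Ioo_hasDerivAt₀ 0
  refine ⟨α, hα, ?_⟩
  have hc : ContinuousAt α 0 := (h 0 (by simpa using hε)).continuousAt
  filter_upwards [Ioo_mem_nhds (a := 0 - ε) (b := 0 + ε) (x := 0) (by linarith) (by linarith),
    hc (by rwa [hα])] with t ht hts
  exact ⟨h t ht, hts⟩

/-- If solutions of two autonomous systems starting at ordered points stay ordered, then the
vector fields are ordered in every coordinate in which the initial points agree. -/
lemma apply_le_apply_of_solutions_ordered {ι : Type*} [Fintype ι] {X : Set (ι → ℝ)}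
    (hX : IsOpen X) {f₁ f₂ : (ι → ℝ) → (ι → ℝ)} {x y : ι → ℝ} (hx : x ∈ X) (hy : y ∈ X)
    (hf₁ : ContDiffAt ℝ 1 f₁ x) (hf₂ : ContDiffAt ℝ 1 f₂ y)
    (hmono : ∀ T : ℝ, 0 < T → ∀ x₁ x₂ : ℝ → (ι → ℝ),
      (∀ t ∈ Icc 0 T, x₁ t ∈ X) → (∀ t ∈ Icc 0 T, x₂ t ∈ X) →
      (∀ t ∈ Icc 0 T, HasDerivAt x₁ (f₁ (x₁ t)) t) →
      (∀ t ∈ Icc 0 T, HasDerivAt x₂ (f₂ (x₂ t)) t) →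
      x₁ 0 ≤ x₂ 0 → ∀ t ∈ Icc 0 T, x₁ t ≤ x₂ t)
    (hxy : x ≤ y) {i : ι} (hi : x i = y i) : f₁ x i ≤ f₂ y i := by
  obtain ⟨α, hα, hα'⟩ := hf₁.exists_eventually_hasDerivAt_mem (hX.mem_nhds hx)
  obtain ⟨β, hβ, hβ'⟩ := hf₂.exists_eventually_hasDerivAt_mem (hX.mem_nhds hy)
  obtain ⟨ε, hε, h⟩ := Metric.eventually_nhds_iff.1 (hα'.and hβ')
  have hT : ∀ t ∈ Icc 0 (ε / 2), dist t 0 < ε := fun t ht => by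
    rw [Real.dist_0_eq_abs, abs_of_nonneg ht.1]
    linarith [ht.2]
  have hord := hmono (ε / 2) (half_pos hε) α β (fun t ht => (h (hT t ht)).1.2)
    (fun t ht => (h (hT t ht)).2.2) (fun t ht => (h (hT t ht)).1.1)
    (fun t ht => (h (hT t ht)).2.1) (by rwa [hα, hβ])
  have h0 := h (y := 0) (by simpa using hε)
  have hd := (hasDerivAt_pi.1 h0.2.1 i).sub (hasDerivAt_pi.1 h0.1.1 i)
  rw [hα, hβ] at hd
  refine sub_nonneg.1 (hd.nonneg_of_eventually_le_right ?_)
  filter_upwards [Ioc_mem_nhdsGT (half_pos hε)] with t ht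
  simpa [hα, hβ, hi] using hord t ⟨ht.1.le, ht.2⟩ i

/-- **Metzler/nonnegative Jacobians from monotonicity.**
If the C¹ system `ẋ = g(x,d)` on the open convex sets `X ⊆ ℝⁿ`, `D ⊆ ℝʳ` is
monotone (every pair of solutions with componentwise-ordered constant inputs and
componentwise-ordered initial conditions stays componentwise ordered), then at
every point of `X × D` the state Jacobian is Metzler and the parameter Jacobian
is entrywise nonnegative. -/
theorem metzler_jacobian_of_monotone
    (n r : ℕ)
    (X : Set (Fin n → ℝ)) (D : Set (Fin r → ℝ))
    (hXopen : IsOpen X) (hXconv : Convex ℝ X)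
    (hDopen : IsOpen D) (hDconv : Convex ℝ D)
    (g : (Fin n → ℝ) → (Fin r → ℝ) → (Fin n → ℝ))
    (hg : ContDiffOn ℝ 1 (fun p : (Fin n → ℝ) × (Fin r → ℝ) => g p.1 p.2) (X ×ˢ D))
    (hmono : ∀ d₁ ∈ D, ∀ d₂ ∈ D, d₁ ≤ d₂ →
      ∀ T : ℝ, 0 < T →
      ∀ x₁ x₂ : ℝ → (Fin n → ℝ),
        (∀ t ∈ Icc 0 T, x₁ t ∈ X) → (∀ t ∈ Icc 0 T, x₂ t ∈ X) →
        (∀ t ∈ Icc 0 T, HasDerivAt x₁ (g (x₁ t) d₁) t) →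
        (∀ t ∈ Icc 0 T, HasDerivAt x₂ (g (x₂ t) d₂) t) →
        x₁ 0 ≤ x₂ 0 → ∀ t ∈ Icc 0 T, x₁ t ≤ x₂ t) :
    (∀ x ∈ X, ∀ d ∈ D, ∀ i j : Fin n, i ≠ j →
      0 ≤ fderiv ℝ (fun x' => g x' d i) x (Pi.single j 1)) ∧
    (∀ x ∈ X, ∀ d ∈ D, ∀ (i : Fin n) (j : Fin r),
      0 ≤ fderiv ℝ (fun d' => g x d' i) d (Pi.single j 1)) := by
  have hat : ∀ x ∈ X, ∀ d ∈ D,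
      ContDiffAt ℝ 1 (fun p : (Fin n → ℝ) × (Fin r → ℝ) => g p.1 p.2) (x, d) := fun x hx d hd =>
    hg.contDiffAt ((hXopen.prod hDopen).mem_nhds ⟨hx, hd⟩)
  have hstate : ∀ x ∈ X, ∀ d ∈ D, ContDiffAt ℝ 1 (fun x' => g x' d) x := fun x hx d hd =>
    (hat x hx d hd).comp x (contDiffAt_id.prodMk contDiffAt_const)
  have hparam : ∀ x ∈ X, ∀ d ∈ D, ContDiffAt ℝ 1 (fun d' => g x d') d := fun x hx d hd =>
    (hat x hx d hd).comp d (contDiffAt_const.prodMk contDiffAt_id)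
  have key : ∀ x ∈ X, ∀ y ∈ X, ∀ d₁ ∈ D, ∀ d₂ ∈ D, x ≤ y → d₁ ≤ d₂ → ∀ i, x i = y i →
      g x d₁ i ≤ g y d₂ i := fun x hx y hy d₁ hd₁ d₂ hd₂ hxy hd i hi =>
    apply_le_apply_of_solutions_ordered hXopen hx hy (hstate x hx d₁ hd₁) (hstate y hy d₂ hd₂)
      (hmono d₁ hd₁ d₂ hd₂ hd) hxy hi
  refine ⟨fun x hx d hd i j hij => ?_, fun x hx d hd i j => ?_⟩
  · have hdiff := differentiableAt_pi.1 ((hstate x hx d hd).differentiableAt one_ne_zero) i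
    refine hdiff.fderiv_nonneg_of_eventually_le ?_
    filter_upwards [hXopen.eventually_add_smul_mem_nhdsGT hx (Pi.single j 1),
      self_mem_nhdsWithin] with t ht ht0
    exact key x hx _ ht d hd d hd
      (le_add_of_nonneg_right (smul_nonneg (le_of_lt ht0) (Pi.single_nonneg.2 zero_le_one)))
      le_rfl i (by simp [hij])
  · have hdiff := differentiableAt_pi.1 ((hparam x hx d hd).differentiableAt one_ne_zero) i
    refine hdiff.fderiv_nonneg_of_eventually_le ?_
    filter_upwards [hDopen.eventually_add_smul_mem_nhdsGT hd (Pi.single j 1),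
      self_mem_nhdsWithin] with t ht ht0
    exact key x hx x hx d hd _ ht le_rfl
      (le_add_of_nonneg_right (smul_nonneg (le_of_lt ht0) (Pi.single_nonneg.2 zero_le_one))) i rfl
end

section
/- Let ρ⁽¹⁾, ρ⁽²⁾, φ : ℝ × ℝ → ℝ be differentiable functions with ρ(t,x) := ρ⁽¹⁾(t,x) + ρ⁽²⁾(t,x) > 0 everywhere, and define the mass fraction η := ρ⁽²⁾/ρ. Then the following are equivalent: (i) the partial-density mass conservation equations ∂_t ρ⁽ᵐ⁾ + ∂_x( (ρ⁽ᵐ⁾/ρ) · φ ) = 0 hold for both m = 1 and m = 2; (ii) the total mass conservation equation ∂_t ρ + ∂_x φ = 0 and the concentration advection equation ∂_t η + (φ/ρ) ∂_x η = 0 both hold. -/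
/-- The derivative of `g`, recovered from a positive `r` and the quotient `g / r`. -/
theorem deriv_eq_of_div {g r : ℝ → ℝ} {x : ℝ} (hg : DifferentiableAt ℝ g x)
    (hr : DifferentiableAt ℝ r x) (h0 : r x ≠ 0) :
    deriv g x = g x / r x * deriv r x + r x * deriv (fun y => g y / r y) x := by
  rw [deriv_fun_div hg hr h0]
  field_simp
  ring

/-- The fluxes `f / (f + g) * h` and `g / (f + g) * h` have derivatives summing to that of `h`. -/
theorem deriv_div_add_mul_eq_sub {f g h : ℝ → ℝ} {x : ℝ} (hf : DifferentiableAt ℝ f x)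
    (hg : DifferentiableAt ℝ g x) (hh : DifferentiableAt ℝ h x) (h0 : ∀ y, f y + g y ≠ 0) :
    deriv (fun y => f y / (f y + g y) * h y) x
      = deriv h x - deriv (fun y => g y / (f y + g y) * h y) x := by
  rw [← deriv_fun_sub hh (((hg.fun_div (hf.fun_add hg) (h0 x))).fun_mul hh)]
  congr 1
  funext y
  have := h0 y
  field_simp
  ring

/-- **Equivalence of the partial-density formulation and the total
density/concentration formulation of mass conservation for a two-gas mixture.**
With total density `ρ = ρ⁽¹⁾ + ρ⁽²⁾ > 0` and mass fraction `η = ρ⁽²⁾/ρ`, the two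
partial-density conservation laws `∂_t ρ⁽ᵐ⁾ + ∂_x((ρ⁽ᵐ⁾/ρ)φ) = 0` (m = 1, 2) hold
everywhere if and only if the total mass conservation law `∂_t ρ + ∂_x φ = 0` and
the concentration advection equation `∂_t η + (φ/ρ) ∂_x η = 0` hold everywhere. -/
theorem partial_density_iff_total_density_and_advection
    (ρ₁ ρ₂ φ : ℝ → ℝ → ℝ)
    (hρ₁ : Differentiable ℝ (fun p : ℝ × ℝ => ρ₁ p.1 p.2))
    (hρ₂ : Differentiable ℝ (fun p : ℝ × ℝ => ρ₂ p.1 p.2))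
    (hφ : Differentiable ℝ (fun p : ℝ × ℝ => φ p.1 p.2))
    (hpos : ∀ t x : ℝ, 0 < ρ₁ t x + ρ₂ t x) :
    ((∀ t x : ℝ, deriv (fun s => ρ₁ s x) t
        + deriv (fun y => ρ₁ t y / (ρ₁ t y + ρ₂ t y) * φ t y) x = 0) ∧
     (∀ t x : ℝ, deriv (fun s => ρ₂ s x) t
        + deriv (fun y => ρ₂ t y / (ρ₁ t y + ρ₂ t y) * φ t y) x = 0)) ↔
    ((∀ t x : ℝ, deriv (fun s => ρ₁ s x + ρ₂ s x) t + deriv (fun y => φ t y) x = 0) ∧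
     (∀ t x : ℝ, deriv (fun s => ρ₂ s x / (ρ₁ s x + ρ₂ s x)) t
        + φ t x / (ρ₁ t x + ρ₂ t x)
          * deriv (fun y => ρ₂ t y / (ρ₁ t y + ρ₂ t y)) x = 0)) := by
  have slice_t : ∀ {f : ℝ → ℝ → ℝ}, Differentiable ℝ (fun p : ℝ × ℝ => f p.1 p.2) →
      ∀ t x, DifferentiableAt ℝ (fun s => f s x) t := fun hf t x =>
    (hf (t, x)).comp t (f := fun s : ℝ => (s, x)) (by fun_prop)
  have slice_x : ∀ {f : ℝ → ℝ → ℝ}, Differentiable ℝ (fun p : ℝ × ℝ => f p.1 p.2) →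
      ∀ t x, DifferentiableAt ℝ (fun y => f t y) x := fun hf t x =>
    (hf (t, x)).comp x (f := fun y : ℝ => (t, y)) (by fun_prop)
  simp only [← forall_and]
  refine forall_congr' fun t => forall_congr' fun x => ?_
  have h0 : ∀ t x, ρ₁ t x + ρ₂ t x ≠ 0 := fun t x => (hpos t x).ne'
  have h₁ := slice_t hρ₁ t x
  have h₂ := slice_t hρ₂ t x
  have k₁ := slice_x hρ₁ t x
  have k₂ := slice_x hρ₂ t x
  have kφ := slice_x hφ t x
  have time := deriv_eq_of_div h₂ (h₁.fun_add h₂) (h0 t x)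
  have total := deriv_fun_add h₁ h₂
  have space := deriv_fun_mul (k₂.fun_div (k₁.fun_add k₂) (h0 t x)) kφ
  rw [deriv_div_add_mul_eq_sub k₁ k₂ kφ (h0 t)]
  have hr := h0 t x
  set F := deriv (fun y => ρ₂ t y / (ρ₁ t y + ρ₂ t y) * φ t y) x
  set T := deriv (fun s => ρ₁ s x + ρ₂ s x) t
  set A := deriv (fun s => ρ₂ s x / (ρ₁ s x + ρ₂ s x)) t
  set B := deriv (fun y => ρ₂ t y / (ρ₁ t y + ρ₂ t y)) x
  have partial_eq : deriv (fun s => ρ₂ s x) t + F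
      = ρ₂ t x / (ρ₁ t x + ρ₂ t x) * (T + deriv (fun y => φ t y) x)
        + (ρ₁ t x + ρ₂ t x) * (A + φ t x / (ρ₁ t x + ρ₂ t x) * B) := by
    rw [time, space]
    field_simp
    ring
  constructor
  · rintro ⟨e₁, e₂⟩
    have mass : T + deriv (fun y => φ t y) x = 0 := by linarith
    refine ⟨mass, ?_⟩
    rw [e₂, mass, mul_zero, zero_add] at partial_eq
    exact (mul_eq_zero.mp partial_eq.symm).resolve_left hr
  · rintro ⟨mass, adv⟩
    rw [mass, adv, mul_zero, mul_zero, add_zero] at partial_eq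
    exact ⟨by linarith, partial_eq⟩
end
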